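/- In G_φ: if x_i c_j is a positive edge, then there is no bi-path between B and c_j, nor between B and x_i, that passes through both the vertex F and the edge x_i c_j; if x_i c_j is a negative edge, then there is no bi-path between B and c_j, nor between B and x_i, that passes through both the vertex T and the edge x_i c_j. Consequently, no bi-path starting at B crosses both a positive edge and a negative edge. -/

import Mathlib

namespace TemporalPaper

/-- A temporal graph on vertex set `V`: an undirected labeling assigning to each
(unordered) pair of vertices a finite set of rational time labels; a pair is an
edge of the graph iff its label set is nonempty. -/
structure TemporalGraph (V : Type*) where
  label : V → V → Finset ℚ
  symm : ∀ u v, label u v = label v u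
  loopless : ∀ v, label v v = ∅

namespace TemporalGraph

variable {V : Type*}

/-- The footprint (static underlying graph) of a temporal graph. -/
def footprint (G : TemporalGraph V) : SimpleGraph V where
  Adj u v := (G.label u v).Nonempty
  symm := ⟨fun u v h => by rwa [G.symm]⟩
  loopless := ⟨fun v h => by rw [G.loopless] at h; exact Finset.not_nonempty_empty h⟩

/-- The snapshot of a temporal graph at time `t`. -/
def snapshot (G : TemporalGraph V) (t : ℚ) : SimpleGraph V where
  Adj u v := t ∈ G.label u v
  symm := ⟨fun u v h => by rwa [G.symm]⟩
  loopless := ⟨fun v h => by rw [G.loopless] at h; exact absurd h (Finset.notMem_empty t)⟩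

/-- `G.IsTJ r p ts` : the list of vertices `p` together with the list of times `ts`
(one per consecutive pair of vertices of `p`) forms a temporal walk, i.e. each time
belongs to the labels of the corresponding edge, and consecutive times satisfy `r`
(`r = (· ≤ ·)` for non-strict temporal walks, `r = (· < ·)` for strict ones). -/
inductive IsTJ (G : TemporalGraph V) (r : ℚ → ℚ → Prop) : List V → List ℚ → Prop
  | single (v : V) : IsTJ G r [v] []
  | cons {u v : V} {p : List V} {t : ℚ} {ts : List ℚ} :
      t ∈ G.label u v → IsTJ G r (v :: p) ts →
      (∀ t' ∈ ts.head?, r t t') → IsTJ G r (u :: v :: p) (t :: ts)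

/-- A temporal path from `u` to `v` with underlying (vertex-)path `p` and times `ts`. -/
def TPath (G : TemporalGraph V) (r : ℚ → ℚ → Prop) (u v : V)
    (p : List V) (ts : List ℚ) : Prop :=
  G.IsTJ r p ts ∧ p.Nodup ∧ p.head? = some u ∧ p.getLast? = some v

/-- Temporal reachability. -/
def Reach (G : TemporalGraph V) (r : ℚ → ℚ → Prop) (u v : V) : Prop :=
  ∃ p ts, G.TPath r u v p ts

def TemporallyConnectedRel (G : TemporalGraph V) (r : ℚ → ℚ → Prop) : Prop :=
  ∀ u v : V, u ≠ v → G.Reach r u v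

/-- Temporal connectivity (non-strict setting). -/
def TemporallyConnected (G : TemporalGraph V) : Prop :=
  G.TemporallyConnectedRel (· ≤ ·)

/-- A bidirectional temporal path (bi-path) between `u` and `v` on the underlying
path `p` (from `u` to `v`): a temporal path in each direction along `p`. -/
def BiPath (G : TemporalGraph V) (r : ℚ → ℚ → Prop) (u v : V)
    (p : List V) (ts₁ ts₂ : List ℚ) : Prop :=
  G.TPath r u v p ts₁ ∧ G.TPath r v u p.reverse ts₂

def BiConnectedRel (G : TemporalGraph V) (r : ℚ → ℚ → Prop) : Prop :=
  ∀ u v : V, u ≠ v → ∃ p ts₁ ts₂, G.BiPath r u v p ts₁ ts₂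

/-- Bidirectional temporal connectivity (non-strict setting). -/
def BiConnected (G : TemporalGraph V) : Prop := G.BiConnectedRel (· ≤ ·)

/-- `H` is a temporal subgraph of `G` (on the same vertex set). -/
def IsSubgraph (H G : TemporalGraph V) : Prop := ∀ u v, H.label u v ⊆ G.label u v

/-- A temporal spanner of `G`: a temporally connected temporal subgraph on all of `V`. -/
def IsSpanner (H G : TemporalGraph V) : Prop := H.IsSubgraph G ∧ H.TemporallyConnected

/-- A temporal spanning tree of `G`: a temporal spanner whose footprint is a tree. -/
def IsSpanningTree (H G : TemporalGraph V) : Prop := H.IsSpanner G ∧ H.footprint.IsTree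

/-- A bidirectional temporal spanner (bi-spanner) of `G`. -/
def IsBiSpanner (H G : TemporalGraph V) : Prop := H.IsSpanner G ∧ H.BiConnected

/-- A temporal graph is simple if every edge has exactly one time label,
i.e. every label set has at most one element (edges have nonempty label sets). -/
def Simple (G : TemporalGraph V) : Prop := ∀ u v, (G.label u v).card ≤ 1

/-- A temporal graph is proper if any two (distinct) edges sharing a vertex have
disjoint label sets. -/
def Proper (G : TemporalGraph V) : Prop :=
  ∀ u v w : V, v ≠ w → Disjoint (G.label u v) (G.label u w)

def Happy (G : TemporalGraph V) : Prop := G.Simple ∧ G.Proper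

/-- `u` can reach `v` by a (non-strict) temporal path arriving at time at most `t`. -/
def ArrivesBy (G : TemporalGraph V) (u v : V) (t : ℚ) : Prop :=
  ∃ p ts, G.TPath (· ≤ ·) u v p ts ∧ ∀ t' ∈ ts.getLast?, t' ≤ t

/-- `u` can reach `v` by a (non-strict) temporal path departing at time at least `t`. -/
def DepartsAfter (G : TemporalGraph V) (u v : V) (t : ℚ) : Prop :=
  ∃ p ts, G.TPath (· ≤ ·) u v p ts ∧ ∀ t' ∈ ts.head?, t ≤ t'

/-- A pivot: some time `t` such that every other vertex reaches `x` by time `t`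
and `x` reaches every other vertex departing not earlier than `t`. -/
def IsPivot (G : TemporalGraph V) (x : V) : Prop :=
  ∃ t : ℚ, ∀ u : V, u ≠ x → G.ArrivesBy u x t ∧ G.DepartsAfter x u t

/-- Deleting the (undirected) edge `ab` from a temporal graph. -/
def deleteEdge [DecidableEq V] (G : TemporalGraph V) (a b : V) : TemporalGraph V where
  label u v := if (u = a ∧ v = b) ∨ (u = b ∧ v = a) then ∅ else G.label u v
  symm := by
    intro u v
    have h : ((u = a ∧ v = b) ∨ (u = b ∧ v = a)) ↔ ((v = a ∧ u = b) ∨ (v = b ∧ u = a)) := by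
      tauto
    rw [G.symm, if_congr h rfl rfl]
  loopless := by
    intro v
    split_ifs with h
    · rfl
    · exact G.loopless v

end TemporalGraph

end TemporalPaper

namespace TemporalPaper

open TemporalGraph

/-- Vertices of the temporal graph `G_φ` built from a CNF formula `φ` with `n`
variables and `k` clauses: one vertex per variable, one per clause, and three special
vertices `T`, `F`, `B`. -/
inductive Vphi (n k : ℕ) : Type
  | var : Fin n → Vphi n k
  | cls : Fin k → Vphi n k
  | T : Vphi n k
  | F : Vphi n k
  | B : Vphi n k
deriving DecidableEq

/-- The reference time `t⁺ = n + k + 1`. -/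
def tpos (n k : ℕ) : ℚ := n + k + 1

/-- The reference time `t⁻ = -t⁺`. -/
def tneg (n k : ℕ) : ℚ := -(tpos n k)

/-- The value `ε`, a fixed rational with `0 < ε < 1`. -/
def eps : ℚ := 1/2

/-- One orientation of the labeling of `G_φ`. The formula `φ` is encoded by
`φ j i = some true` if variable `x_i` occurs positively in clause `c_j`,
`φ j i = some false` if it occurs negatively, and `φ j i = none` if it does not occur
(so no clause contains both a variable and its negation). Variable and clause indices
are taken `1`-based (`i+1`, `j+1`) as in the paper. -/
def corePhi (n k : ℕ) (φ : Fin k → Fin n → Option Bool) :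
    Vphi n k → Vphi n k → Finset ℚ
  | .B, .T => {tneg n k, eps}
  | .B, .F => {-eps, tpos n k}
  | .T, .var i => {tneg n k - ((i : ℚ) + 1), (i : ℚ) + 1}
  | .F, .var i => {-((i : ℚ) + 1), tpos n k + ((i : ℚ) + 1)}
  | .var i, .cls j =>
      match φ j i with
      | some true => {tneg n k - (((i : ℚ) + 1) + ((j : ℚ) + 1)),
                      ((i : ℚ) + 1) + ((j : ℚ) + 1)}
      | some false => {-(((i : ℚ) + 1) + ((j : ℚ) + 1)),
                       tpos n k + (((i : ℚ) + 1) + ((j : ℚ) + 1))}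
      | none => ∅
  | _, _ => ∅

/-- The temporal graph `G_φ` of the reduction from SAT to TST. -/
def Gphi (n k : ℕ) (φ : Fin k → Fin n → Option Bool) : TemporalGraph (Vphi n k) where
  label u v := corePhi n k φ u v ∪ corePhi n k φ v u
  symm := fun u v => Finset.union_comm _ _
  loopless := fun v => by cases v <;> rfl

/-- The edge `x_i c_j` is a positive edge of `G_φ`. -/
def PosEdge {n k : ℕ} (φ : Fin k → Fin n → Option Bool) (i : Fin n) (j : Fin k) : Prop :=
  φ j i = some true

/-- The edge `x_i c_j` is a negative edge of `G_φ`. -/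
def NegEdge {n k : ℕ} (φ : Fin k → Fin n → Option Bool) (i : Fin n) (j : Fin k) : Prop :=
  φ j i = some false

/-- `φ` is satisfiable: some assignment makes a literal of every clause true. -/
def Satisfiable {n k : ℕ} (φ : Fin k → Fin n → Option Bool) : Prop :=
  ∃ σ : Fin n → Bool, ∀ j : Fin k, ∃ i : Fin n, ∃ b : Bool, φ j i = some b ∧ σ i = b

end TemporalPaper

namespace TemporalPaper

/-- The (vertex-)path `p` crosses the undirected edge `ab`, i.e. `a` and `b` occur
consecutively (in either order) in `p`. -/
def Crosses {V : Type*} (p : List V) (a b : V) : Prop :=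
  [a, b] <:+: p ∨ [b, a] <:+: p

namespace TemporalGraph

variable {V : Type*} {G : TemporalGraph V} {r : ℚ → ℚ → Prop}

theorem IsTJ.concat {p : List V} {ts : List ℚ} {u v : V} {t : ℚ} (h : G.IsTJ r p ts)
    (hp : p.getLast? = some u) (ht : t ∈ G.label u v) (hr : ∀ t' ∈ ts.getLast?, r t' t) :
    G.IsTJ r (p ++ [v]) (ts ++ [t]) := by
  induction h with
  | single w =>
    obtain rfl : w = u := by simpa using hp
    exact .cons ht (.single v) (by simp)
  | @cons a b q s ss hs hq hh ih =>
    refine .cons hs (ih (by simpa using hp) ?_) ?_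
    · intro t' ht'
      apply hr
      cases ss <;> simp_all
    · intro t' ht'
      cases ss <;> simp_all

/-- Reading a temporal walk backwards reverses the order relation on its times. -/
theorem IsTJ.reverse {p : List V} {ts : List ℚ} (h : G.IsTJ r p ts) :
    G.IsTJ (fun s t => r t s) p.reverse ts.reverse := by
  induction h with
  | single v => exact .single v
  | @cons a b q s ss hs hq hh ih =>
    rw [List.reverse_cons (a := a), List.reverse_cons (a := s)]
    exact ih.concat (u := b) (by simp) (by rwa [G.symm]) (by simpa using hh)

/-- If the first time of a temporal walk is related to `t₀`, every edge of the walk has a label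
related to `t₀`. -/
theorem IsTJ.exists_label_of_infix (hr : ∀ ⦃a b c⦄, r a b → r b c → r a c) {p : List V}
    {ts : List ℚ} (h : G.IsTJ r p ts) {t₀ : ℚ} (h₀ : ∀ t ∈ ts.head?, r t₀ t) {a b : V}
    (hab : [a, b] <:+: p) : ∃ s ∈ G.label a b, r t₀ s := by
  induction h with
  | single v => simpa using hab.length_le
  | @cons u v q t ts' ht hq hh ih =>
    have h₁ : r t₀ t := h₀ t (by simp)
    rcases List.infix_cons_iff.1 hab with hpre | hinf
    · obtain ⟨rfl, rfl⟩ : a = u ∧ b = v := by simpa using hpre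
      exact ⟨t, ht, h₁⟩
    · exact ih (fun t' ht' => hr h₁ (hh t' ht')) hinf

end TemporalGraph

theorem exists_pair_infix_of_mem {V : Type*} {p : List V} {u v : V}
    (hp : p.head? = some u) (hv : v ∈ p) (huv : v ≠ u) : ∃ a, [a, v] <:+: p := by
  obtain ⟨l₁, l₂, rfl⟩ := List.append_of_mem hv
  rcases List.eq_nil_or_concat l₁ with rfl | ⟨l, a, rfl⟩
  · exact absurd (by simpa using hp) huv
  · exact ⟨a, l, l₂, by simp⟩

section Labels

variable {n k : ℕ} {φ : Fin k → Fin n → Option Bool}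

theorem fin_cast_add_lt_tpos (i : Fin n) (j : Fin k) :
    ((i : ℚ) + 1) + ((j : ℚ) + 1) < tpos n k := by
  have hi : (i : ℚ) + 1 ≤ n := by exact_mod_cast i.isLt
  have hj : (j : ℚ) + 1 ≤ k := by exact_mod_cast j.isLt
  unfold tpos
  linarith

theorem fin_cast_lt_tpos (i : Fin n) : (i : ℚ) + 1 < tpos n k := by
  have hi : (i : ℚ) + 1 ≤ n := by exact_mod_cast i.isLt
  have hk : (0 : ℚ) ≤ k := k.cast_nonneg
  unfold tpos
  linarith

theorem one_le_tpos : 1 ≤ tpos n k := by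
  unfold tpos
  have := n.cast_nonneg (α := ℚ)
  have := k.cast_nonneg (α := ℚ)
  linarith

theorem tneg_le_label_F {a : Vphi n k} {s : ℚ} (hs : s ∈ (Gphi n k φ).label a .F) :
    tneg n k ≤ s := by
  have h1 : 1 ≤ tpos n k := one_le_tpos
  cases a with
  | var i =>
    have := fin_cast_lt_tpos (k := k) i
    have : (0 : ℚ) ≤ i := Nat.cast_nonneg _
    simp only [Gphi, corePhi, Finset.empty_union, Finset.mem_insert, Finset.mem_singleton] at hs
    unfold tneg
    rcases hs with rfl | rfl <;> linarith
  | B =>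
    simp only [Gphi, corePhi, Finset.union_empty, Finset.mem_insert, Finset.mem_singleton] at hs
    unfold tneg
    unfold eps at hs
    rcases hs with rfl | rfl <;> linarith
  | _ => simp [Gphi, corePhi] at hs

theorem label_T_le_tpos {a : Vphi n k} {s : ℚ} (hs : s ∈ (Gphi n k φ).label a .T) :
    s ≤ tpos n k := by
  have h1 : 1 ≤ tpos n k := one_le_tpos
  cases a with
  | var i =>
    have := fin_cast_lt_tpos (k := k) i
    have : (0 : ℚ) ≤ i := Nat.cast_nonneg _
    simp only [Gphi, corePhi, Finset.empty_union, Finset.mem_insert, Finset.mem_singleton] at hs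
    unfold tneg at hs
    rcases hs with rfl | rfl <;> linarith
  | B =>
    simp only [Gphi, corePhi, Finset.union_empty, Finset.mem_insert, Finset.mem_singleton] at hs
    unfold tneg eps at hs
    rcases hs with rfl | rfl <;> linarith
  | _ => simp [Gphi, corePhi] at hs

theorem PosEdge.label_le_tpos {i : Fin n} {j : Fin k} (h : PosEdge φ i j) {s : ℚ}
    (hs : s ∈ (Gphi n k φ).label (.var i) (.cls j)) : s ≤ tpos n k := by
  have := fin_cast_add_lt_tpos i j
  have : (0 : ℚ) ≤ i := Nat.cast_nonneg _
  have : (0 : ℚ) ≤ j := Nat.cast_nonneg _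
  unfold PosEdge at h
  simp only [Gphi, corePhi, h, Finset.union_empty, Finset.mem_insert, Finset.mem_singleton] at hs
  unfold tneg at hs
  rcases hs with rfl | rfl <;> linarith

theorem NegEdge.tneg_le_label {i : Fin n} {j : Fin k} (h : NegEdge φ i j) {s : ℚ}
    (hs : s ∈ (Gphi n k φ).label (.var i) (.cls j)) : tneg n k ≤ s := by
  have := fin_cast_add_lt_tpos i j
  have : (0 : ℚ) ≤ i := Nat.cast_nonneg _
  have : (0 : ℚ) ≤ j := Nat.cast_nonneg _
  unfold NegEdge at h
  simp only [Gphi, corePhi, h, Finset.union_empty, Finset.mem_insert, Finset.mem_singleton] at hs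
  unfold tneg
  rcases hs with rfl | rfl <;> linarith

theorem label_B_T_le_eps {s : ℚ} (hs : s ∈ (Gphi n k φ).label .B .T) : s ≤ eps := by
  have h1 : 1 ≤ tpos n k := one_le_tpos
  simp only [Gphi, corePhi, Finset.union_empty, Finset.mem_insert, Finset.mem_singleton] at hs
  unfold tneg eps at *
  rcases hs with rfl | rfl <;> linarith

theorem neg_eps_le_label_B_F {s : ℚ} (hs : s ∈ (Gphi n k φ).label .B .F) : -eps ≤ s := by
  have h1 : 1 ≤ tpos n k := one_le_tpos
  simp only [Gphi, corePhi, Finset.union_empty, Finset.mem_insert, Finset.mem_singleton] at hs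
  unfold eps at *
  rcases hs with rfl | rfl <;> linarith

theorem label_T_lt_tneg {v : Vphi n k} (hv : v ≠ .B) {s : ℚ}
    (hs : s ∈ (Gphi n k φ).label .T v) (hle : s ≤ eps) : s < tneg n k := by
  cases v with
  | var i =>
    have : (0 : ℚ) ≤ i := Nat.cast_nonneg _
    simp only [Gphi, corePhi, Finset.union_empty, Finset.mem_insert, Finset.mem_singleton] at hs
    unfold eps at hle
    rcases hs with rfl | rfl <;> linarith
  | B => exact absurd rfl hv
  | _ => simp [Gphi, corePhi] at hs

theorem tpos_lt_label_F {v : Vphi n k} (hv : v ≠ .B) {s : ℚ}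
    (hs : s ∈ (Gphi n k φ).label .F v) (hle : -eps ≤ s) : tpos n k < s := by
  cases v with
  | var i =>
    have : (0 : ℚ) ≤ i := Nat.cast_nonneg _
    simp only [Gphi, corePhi, Finset.union_empty, Finset.mem_insert, Finset.mem_singleton] at hs
    unfold eps at hle
    rcases hs with rfl | rfl <;> linarith
  | B => exact absurd rfl hv
  | _ => simp [Gphi, corePhi] at hs

end Labels

section BiPaths

variable {n k : ℕ} {φ : Fin k → Fin n → Option Bool}

/-- Beyond the first edge, a descending walk starting with `B, T` only uses labels below `t⁻`. -/
theorem exists_label_lt_tneg {q : List (Vphi n k)} {ts : List ℚ}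
    (h : (Gphi n k φ).IsTJ (fun s t => t ≤ s) (.B :: .T :: q) ts)
    (hnd : (Vphi.B :: Vphi.T :: q).Nodup) {a b : Vphi n k}
    (hab : [a, b] <:+: .B :: .T :: q) :
    (a = .B ∧ b = .T) ∨ ∃ s ∈ (Gphi n k φ).label a b, s < tneg n k := by
  rcases List.infix_cons_iff.1 hab with hpre | hinf
  · left
    simpa using hpre
  right
  cases h with
  | cons h₁ htail hhead =>
    cases htail with
    | single => simpa using hinf.length_le
    | @cons _ v _ s ss h₂ ht₂ hh₂ =>
      have hs : s < tneg n k := label_T_lt_tneg (by rintro rfl; simp at hnd) h₂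
        ((hhead s (by simp)).trans (label_B_T_le_eps h₁))
      obtain ⟨s', hs', hle⟩ := TemporalGraph.IsTJ.exists_label_of_infix (r := (fun s t => t ≤ s))
        (fun _ _ _ h h' => le_trans h' h) (.cons h₂ ht₂ hh₂) (t₀ := s) (by simp) hinf
      exact ⟨s', hs', hle.trans_lt hs⟩

/-- Beyond the first edge, an ascending walk starting with `B, F` only uses labels above `t⁺`. -/
theorem exists_tpos_lt_label {q : List (Vphi n k)} {ts : List ℚ}
    (h : (Gphi n k φ).IsTJ (· ≤ ·) (.B :: .F :: q) ts)
    (hnd : (Vphi.B :: Vphi.F :: q).Nodup) {a b : Vphi n k}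
    (hab : [a, b] <:+: .B :: .F :: q) :
    (a = .B ∧ b = .F) ∨ ∃ s ∈ (Gphi n k φ).label a b, tpos n k < s := by
  rcases List.infix_cons_iff.1 hab with hpre | hinf
  · left
    simpa using hpre
  right
  cases h with
  | cons h₁ htail hhead =>
    cases htail with
    | single => simpa using hinf.length_le
    | @cons _ v _ s ss h₂ ht₂ hh₂ =>
      have hs : tpos n k < s := tpos_lt_label_F (by rintro rfl; simp at hnd) h₂
        ((neg_eps_le_label_B_F h₁).trans (hhead s (by simp)))
      obtain ⟨s', hs', hle⟩ := TemporalGraph.IsTJ.exists_label_of_infix (r := (· ≤ ·))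
        (fun _ _ _ h h' => le_trans h h') (.cons h₂ ht₂ hh₂) (t₀ := s) (by simp) hinf
      exact ⟨s', hs', hs.trans_le hle⟩

/-- The edges of a bi-path from `B` either all have labels below `t⁻`, or all have labels above
`t⁺`, except for the first edge. -/
theorem biPath_B_dichotomy {w : Vphi n k} {p : List (Vphi n k)} {ts₁ ts₂ : List ℚ}
    (h : (Gphi n k φ).BiPath (· ≤ ·) .B w p ts₁ ts₂) :
    (∀ a b, [a, b] <:+: p →
      (a = .B ∧ b = .T) ∨ ∃ s ∈ (Gphi n k φ).label a b, s < tneg n k) ∨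
    (∀ a b, [a, b] <:+: p →
      (a = .B ∧ b = .F) ∨ ∃ s ∈ (Gphi n k φ).label a b, tpos n k < s) := by
  obtain ⟨⟨hfwd, hnd, hhd, -⟩, hbwd, -⟩ := h
  have hdesc := hbwd.reverse
  rw [List.reverse_reverse] at hdesc
  cases hfwd with
  | single v => exact .inl fun a b hab => by simpa using hab.length_le
  | @cons u v q t ts ht hq hh =>
    obtain rfl : u = .B := by simpa using hhd
    cases v with
    | T => exact .inl fun a b hab => exists_label_lt_tneg hdesc hnd hab
    | F => exact .inr fun a b hab => exists_tpos_lt_label (.cons ht hq hh) hnd hab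
    | _ => simp [Gphi, corePhi] at ht

/-- A bi-path from `B` avoids `F` and all negative edges, or avoids `T` and all positive edges. -/
theorem biPath_B_avoids {w : Vphi n k} {p : List (Vphi n k)} {ts₁ ts₂ : List ℚ}
    (h : (Gphi n k φ).BiPath (· ≤ ·) .B w p ts₁ ts₂) :
    (.F ∉ p ∧ ∀ i j, NegEdge φ i j → ¬ Crosses p (.var i) (.cls j)) ∨
    (.T ∉ p ∧ ∀ i j, PosEdge φ i j → ¬ Crosses p (.var i) (.cls j)) := by
  have hhd := h.1.2.2.1
  rcases biPath_B_dichotomy h with hd | hd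
  · refine .inl ⟨fun hF => ?_, fun i j hij hc => ?_⟩
    · obtain ⟨a, ha⟩ := exists_pair_infix_of_mem hhd hF (by simp)
      rcases hd _ _ ha with ⟨-, hb⟩ | ⟨s, hs, hlt⟩
      · simp at hb
      · exact (tneg_le_label_F hs).not_gt hlt
    · rcases hc with hc | hc <;> rcases hd _ _ hc with ⟨hb, -⟩ | ⟨s, hs, hlt⟩
      · simp at hb
      · exact (hij.tneg_le_label hs).not_gt hlt
      · simp at hb
      · exact (hij.tneg_le_label (by rwa [(Gphi n k φ).symm])).not_gt hlt
  · refine .inr ⟨fun hT => ?_, fun i j hij hc => ?_⟩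
    · obtain ⟨a, ha⟩ := exists_pair_infix_of_mem hhd hT (by simp)
      rcases hd _ _ ha with ⟨-, hb⟩ | ⟨s, hs, hlt⟩
      · simp at hb
      · exact (label_T_le_tpos hs).not_gt hlt
    · rcases hc with hc | hc <;> rcases hd _ _ hc with ⟨hb, -⟩ | ⟨s, hs, hlt⟩
      · simp at hb
      · exact (hij.label_le_tpos hs).not_gt hlt
      · simp at hb
      · exact (hij.label_le_tpos (by rwa [(Gphi n k φ).symm])).not_gt hlt

end BiPaths

/-- Claim 2: in `G_φ`, if `x_i c_j` is a positive edge, then no bi-path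
between `B` and `c_j`, nor between `B` and `x_i`, passes through both the vertex `F`
and the edge `x_i c_j`; if `x_i c_j` is a negative edge, then no bi-path between `B`
and `c_j`, nor between `B` and `x_i`, passes through both the vertex `T` and the edge
`x_i c_j`. Consequently, no bi-path starting at `B` crosses both a positive edge and
a negative edge. -/
theorem stmt14 (n k : ℕ) (φ : Fin k → Fin n → Option Bool) :
    (∀ (i : Fin n) (j : Fin k), PosEdge φ i j →
      ∀ (w : Vphi n k), (w = Vphi.cls j ∨ w = Vphi.var i) →
      ∀ (p : List (Vphi n k)) (ts₁ ts₂ : List ℚ),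
        (Gphi n k φ).BiPath (· ≤ ·) Vphi.B w p ts₁ ts₂ →
        ¬ (Vphi.F ∈ p ∧ Crosses p (Vphi.var i) (Vphi.cls j))) ∧
    (∀ (i : Fin n) (j : Fin k), NegEdge φ i j →
      ∀ (w : Vphi n k), (w = Vphi.cls j ∨ w = Vphi.var i) →
      ∀ (p : List (Vphi n k)) (ts₁ ts₂ : List ℚ),
        (Gphi n k φ).BiPath (· ≤ ·) Vphi.B w p ts₁ ts₂ →
        ¬ (Vphi.T ∈ p ∧ Crosses p (Vphi.var i) (Vphi.cls j))) ∧
    (∀ (i i' : Fin n) (j j' : Fin k), PosEdge φ i j → NegEdge φ i' j' →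
      ∀ (w : Vphi n k) (p : List (Vphi n k)) (ts₁ ts₂ : List ℚ),
        (Gphi n k φ).BiPath (· ≤ ·) Vphi.B w p ts₁ ts₂ →
        ¬ (Crosses p (Vphi.var i) (Vphi.cls j) ∧
           Crosses p (Vphi.var i') (Vphi.cls j'))) := by
  refine ⟨fun i j hij w _ p ts₁ ts₂ h hc => ?_, fun i j hij w _ p ts₁ ts₂ h hc => ?_,
    fun i i' j j' hij hij' w p ts₁ ts₂ h hc => ?_⟩
  · rcases biPath_B_avoids h with ⟨hF, -⟩ | ⟨-, hP⟩
    · exact hF hc.1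
    · exact hP i j hij hc.2
  · rcases biPath_B_avoids h with ⟨-, hN⟩ | ⟨hT, -⟩
    · exact hN i j hij hc.2
    · exact hT hc.1
  · rcases biPath_B_avoids h with ⟨-, hN⟩ | ⟨-, hP⟩
    · exact hN i' j' hij' hc.2
    · exact hP i j hij hc.1

end TemporalPaper
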